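/- Let G be a finite simple connected graph and k ∈ ℕ. If two k-district maps Π and Π' of G lie in the same connected component of the switch graph Γ_k(G), then Π is contractible if and only if Π' is contractible. In other words, contractibility (resp., incontractibility) of a k-district map is invariant under switch operations. -/

import Mathlib

open SimpleGraph

universe u

/-- A vertex `v` is a cut vertex of `G` if its removal disconnects `G`. -/
def IsCutVertex {V : Type u} (G : SimpleGraph V) (v : V) : Prop :=
  ¬ (G.induce ({v}ᶜ : Set V)).Connected

/-- `G` is biconnected: it is connected and either consists of a single edge or has at
least three vertices and remains connected after the deletion of any single vertex. -/
def Biconnected {V : Type u} (G : SimpleGraph V) : Prop :=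
  G.Connected ∧
  ((∃ a b : V, a ≠ b ∧ G.Adj a b ∧ (Set.univ : Set V) = {a, b}) ∨
   (3 ≤ Nat.card V ∧ ∀ v : V, (G.induce ({v}ᶜ : Set V)).Connected))

/-- A set of vertices inducing a biconnected subgraph of `G`. -/
def IsBiconnectedSet {V : Type u} (G : SimpleGraph V) (s : Set V) : Prop :=
  (G.induce s).Connected ∧
  ((∃ a b : V, a ≠ b ∧ G.Adj a b ∧ s = {a, b}) ∨
   (3 ≤ s.ncard ∧ ∀ v ∈ s, (G.induce (s \ {v})).Connected))

/-- A block of `G`: the vertex set of a maximal biconnected subgraph. -/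
def IsBlock {V : Type u} (G : SimpleGraph V) (s : Set V) : Prop :=
  IsBiconnectedSet G s ∧ ∀ t : Set V, IsBiconnectedSet G t → s ⊆ t → t = s

/-- A leaf block of `G`: a block that is a leaf of the block tree, i.e. a block
containing at most one cut vertex of `G`. -/
def IsLeafBlock {V : Type u} (G : SimpleGraph V) (s : Set V) : Prop :=
  IsBlock G s ∧ ({v ∈ s | IsCutVertex G v}).ncard ≤ 1

/-- A `k`-district map of `G`: a partition of the vertex set of `G` into `k` nonempty
subsets (districts), each of which induces a connected subgraph of `G`. -/
structure DistrictMap {V : Type u} (G : SimpleGraph V) (k : ℕ) where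
  parts : Set (Set V)
  ncard_parts : parts.ncard = k
  nonempty_mem : ∀ s ∈ parts, s.Nonempty
  pairwise_disjoint : parts.Pairwise Disjoint
  covers : ∀ v : V, ∃ s ∈ parts, v ∈ s
  connected_mem : ∀ s ∈ parts, (G.induce s).Connected

section SwitchDefs

variable {V : Type u} {G : SimpleGraph V} {k : ℕ}

/-- The switch operation `switch_P(u,v,w)` is defined: `(u,v,w)` is a path of `G`,
`P(u) = P(v) ≠ P(w)`, and `P(v) \ {v}` is nonempty and induces a connected subgraph. -/
def SwitchDefined (P : DistrictMap G k) (u v w : V) : Prop :=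
  ∃ su sw : Set V,
    G.Adj u v ∧ G.Adj v w ∧
    su ∈ P.parts ∧ sw ∈ P.parts ∧ u ∈ su ∧ v ∈ su ∧ w ∈ sw ∧ su ≠ sw ∧
    (su \ {v} : Set V).Nonempty ∧ (G.induce (su \ {v})).Connected

/-- `Q = switch_P(u,v,w)`: the district map obtained from `P` by moving `v`
from `P(v)` to `P(w)`. -/
def SwitchedAt (P Q : DistrictMap G k) (u v w : V) : Prop :=
  ∃ su sw : Set V,
    G.Adj u v ∧ G.Adj v w ∧
    su ∈ P.parts ∧ sw ∈ P.parts ∧ u ∈ su ∧ v ∈ su ∧ w ∈ sw ∧ su ≠ sw ∧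
    (su \ {v} : Set V).Nonempty ∧ (G.induce (su \ {v})).Connected ∧
    Q.parts = (P.parts \ {su, sw}) ∪ {su \ {v}, insert v sw}

/-- `Q` is obtained from `P` by a single switch. -/
def Switch (P Q : DistrictMap G k) : Prop := ∃ u v w : V, SwitchedAt P Q u v w

/-- Adjacency in the switch graph `Γ_k(G)`. -/
def SwitchAdj (P Q : DistrictMap G k) : Prop := Switch P Q ∨ Switch Q P

/-- `f 0, f 1, …, f m` is a walk in the switch graph `Γ_k(G)`. -/
def SwitchChain (f : ℕ → DistrictMap G k) (m : ℕ) : Prop :=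
  ∀ i < m, SwitchAdj (f i) (f (i + 1))

/-- A single switch taking `P` to `Q` that contracts the district `s` to `s' = s \ {v}`. -/
def SwitchOut (P Q : DistrictMap G k) (s s' : Set V) : Prop :=
  ∃ u v w : V, ∃ sw : Set V,
    G.Adj u v ∧ G.Adj v w ∧
    s ∈ P.parts ∧ sw ∈ P.parts ∧ u ∈ s ∧ v ∈ s ∧ w ∈ sw ∧ s ≠ sw ∧
    s' = s \ {v} ∧ s'.Nonempty ∧ (G.induce s').Connected ∧
    Q.parts = (P.parts \ {s, sw}) ∪ {s', insert v sw}

/-- District `s` of `P` can be contracted to the singleton `{t}` by a sequence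
of `|s| - 1` switches. -/
def ContractibleTo (P : DistrictMap G k) (s : Set V) (t : V) : Prop :=
  s ∈ P.parts ∧
  ∃ (f : ℕ → DistrictMap G k) (g : ℕ → Set V),
    f 0 = P ∧ g 0 = s ∧ g (s.ncard - 1) = {t} ∧
    ∀ i < s.ncard - 1, SwitchOut (f i) (f (i + 1)) (g i) (g (i + 1))

/-- District `s` of `P` is contractible. -/
def ContractibleDistrict (P : DistrictMap G k) (s : Set V) : Prop :=
  ∃ t : V, ContractibleTo P s t

/-- A district map is contractible if all of its districts are contractible. -/
def ContractibleMap (P : DistrictMap G k) : Prop :=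
  ∀ s ∈ P.parts, ContractibleDistrict P s

end SwitchDefs

/-- A diamond in `G`: an induced subgraph determined by two cut vertices `v₁, v₂` of `G`
connected by `m ≥ 2` internally disjoint paths, of which at least `m - 1` have exactly one
interior vertex, together with dangling paths from `v₁` and `v₂` to leaves `u₁` and `u₂`. -/
structure Diamond {V : Type u} (G : SimpleGraph V) where
  v₁ : V
  v₂ : V
  u₁ : V
  u₂ : V
  m : ℕ
  two_le_m : 2 ≤ m
  ne_v : v₁ ≠ v₂
  path : Fin m → G.Walk v₁ v₂
  path_isPath : ∀ i, (path i).IsPath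
  internally_disjoint : ∀ i j, i ≠ j →
    {x | x ∈ (path i).support} ∩ {x | x ∈ (path j).support} = {v₁, v₂}
  short : ({i | (path i).length ≠ 2} : Set (Fin m)).ncard ≤ 1
  cut₁ : IsCutVertex G v₁
  cut₂ : IsCutVertex G v₂
  dang₁ : G.Walk v₁ u₁
  dang₂ : G.Walk v₂ u₂
  dang₁_isPath : dang₁.IsPath
  dang₂_isPath : dang₂.IsPath
  leaf₁ : (G.neighborSet u₁).ncard = 1
  leaf₂ : (G.neighborSet u₂).ncard = 1
  dang₁_disjoint : ∀ i, {x | x ∈ dang₁.support} ∩ {x | x ∈ (path i).support} = {v₁}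
  dang₂_disjoint : ∀ i, {x | x ∈ dang₂.support} ∩ {x | x ∈ (path i).support} = {v₂}
  dang_disjoint : {x | x ∈ dang₁.support} ∩ {x | x ∈ dang₂.support} = ∅
  induced : ∀ x y : V,
    x ∈ ({x | ∃ i, x ∈ (path i).support} ∪ {x | x ∈ dang₁.support} ∪
          {x | x ∈ dang₂.support} : Set V) →
    y ∈ ({x | ∃ i, x ∈ (path i).support} ∪ {x | x ∈ dang₁.support} ∪
          {x | x ∈ dang₂.support} : Set V) →
    G.Adj x y →
    (∃ i, s(x, y) ∈ (path i).edges) ∨ s(x, y) ∈ dang₁.edges ∨ s(x, y) ∈ dang₂.edges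

/-- A diamond chain of length `r` in `G`: `r` diamonds `A₁, …, A_r`, where diamond `Aᵢ`
has cut vertices `v₁ i`, `v₂ i`, left path through `a i` and right path through `a (i+1)`
(each with exactly one interior vertex), the interior vertex of the right path of `Aᵢ`
being identified with the interior vertex of the left path of `Aᵢ₊₁`, and leaves
`u₁ i`, `u₂ i` attached by single edges to the cut vertices; the `5r + 1` vertices are
pairwise distinct and each diamond is an induced subgraph of `G`. -/
structure DiamondChain {V : Type u} (G : SimpleGraph V) (r : ℕ) where
  v₁ : Fin r → V
  v₂ : Fin r → V
  a : Fin (r + 1) → V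
  u₁ : Fin r → V
  u₂ : Fin r → V
  adj₁ : ∀ i : Fin r, G.Adj (v₁ i) (a i.castSucc)
  adj₂ : ∀ i : Fin r, G.Adj (a i.castSucc) (v₂ i)
  adj₃ : ∀ i : Fin r, G.Adj (v₁ i) (a i.succ)
  adj₄ : ∀ i : Fin r, G.Adj (a i.succ) (v₂ i)
  adj_u₁ : ∀ i : Fin r, G.Adj (v₁ i) (u₁ i)
  adj_u₂ : ∀ i : Fin r, G.Adj (v₂ i) (u₂ i)
  leaf₁ : ∀ i : Fin r, (G.neighborSet (u₁ i)).ncard = 1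
  leaf₂ : ∀ i : Fin r, (G.neighborSet (u₂ i)).ncard = 1
  cut₁ : ∀ i : Fin r, IsCutVertex G (v₁ i)
  cut₂ : ∀ i : Fin r, IsCutVertex G (v₂ i)
  card_support :
    ({x | (∃ i, x = v₁ i) ∨ (∃ i, x = v₂ i) ∨ (∃ i, x = a i) ∨ (∃ i, x = u₁ i) ∨
      (∃ i, x = u₂ i)} : Set V).ncard = 5 * r + 1
  induced : ∀ i : Fin r, ∀ x y : V,
    x ∈ ({v₁ i, v₂ i, a i.castSucc, a i.succ, u₁ i, u₂ i} : Set V) →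
    y ∈ ({v₁ i, v₂ i, a i.castSucc, a i.succ, u₁ i, u₂ i} : Set V) →
    G.Adj x y →
    s(x, y) ∈ ({s(v₁ i, a i.castSucc), s(a i.castSucc, v₂ i), s(v₁ i, a i.succ),
      s(a i.succ, v₂ i), s(v₁ i, u₁ i), s(v₂ i, u₂ i)} : Set (Sym2 V))

/-- The vertex set of a diamond chain. -/
def DiamondChain.support {V : Type u} {G : SimpleGraph V} {r : ℕ}
    (C : DiamondChain G r) : Set V :=
  {x | (∃ i, x = C.v₁ i) ∨ (∃ i, x = C.v₂ i) ∨ (∃ i, x = C.a i) ∨ (∃ i, x = C.u₁ i) ∨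
    (∃ i, x = C.u₂ i)}

section ClosedSets

variable {V : Type u} {G : SimpleGraph V} {s t : Set V}

theorem SimpleGraph.Connected.eq_univ_of_closed (hG : G.Connected) (hne : t.Nonempty)
    (hcl : ∀ x ∈ t, ∀ y, G.Adj x y → y ∈ t) : t = Set.univ := by
  obtain ⟨x, hx⟩ := hne
  refine Set.eq_univ_of_forall fun y => ?_
  obtain ⟨p⟩ := hG.preconnected x y
  induction p with
  | nil => exact hx
  | cons hadj _ ih => exact ih (hcl _ hx _ hadj)

theorem eq_of_closed_of_induce_connected (hs : (G.induce s).Connected) (hts : t ⊆ s)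
    (hne : t.Nonempty) (hcl : ∀ x ∈ t, ∀ y ∈ s, G.Adj x y → y ∈ t) : t = s := by
  have h : ((↑) ⁻¹' t : Set s) = Set.univ := by
    refine hs.eq_univ_of_closed ?_ fun x hx y hxy => hcl x hx y y.2 hxy
    obtain ⟨x, hx⟩ := hne
    exact ⟨⟨x, hts hx⟩, hx⟩
  exact hts.antisymm (Set.preimage_eq_univ_iff.1 h |>.trans' (by simp))

theorem exists_closed_of_not_induce_connected (hne : s.Nonempty)
    (hs : ¬ (G.induce s).Connected) :
    ∃ t ⊆ s, t.Nonempty ∧ (s \ t).Nonempty ∧ ∀ x ∈ t, ∀ y ∈ s \ t, ¬ G.Adj x y := by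
  have hpre : ¬ (G.induce s).Preconnected := fun h =>
    hs (SimpleGraph.connected_iff _ |>.2 ⟨h, hne.to_subtype⟩)
  simp only [SimpleGraph.Preconnected, not_forall] at hpre
  obtain ⟨x, y, hxy⟩ := hpre
  refine ⟨(↑) '' {z : s | (G.induce s).Reachable x z}, by simp, ⟨x, x, Reachable.refl x, rfl⟩,
    ⟨y, y.2, ?_⟩, ?_⟩
  · rintro ⟨z, hz, hzy⟩
    exact hxy (Subtype.ext hzy ▸ hz)
  · rintro _ ⟨a, ha, rfl⟩ b ⟨hb, hab⟩ hadj
    have : (G.induce s).Adj a ⟨b, hb⟩ := hadj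
    exact hab ⟨⟨b, hb⟩, ha.trans this.reachable, rfl⟩

theorem exists_adj_mem_notMem (hG : G.Connected) (hne : s.Nonempty) (hs : s ≠ Set.univ) :
    ∃ v ∈ s, ∃ w ∉ s, G.Adj v w := by
  by_contra! h
  refine hs (hG.eq_univ_of_closed hne fun x hx y hxy => ?_)
  by_contra hy
  exact h x hx y hy hxy

theorem exists_adj_of_induce_connected (hs : (G.induce s).Connected) {v : V} (hv : v ∈ s)
    (hne : (s \ {v}).Nonempty) : ∃ u ∈ s, G.Adj u v := by
  by_contra! h
  have : {v} = s := eq_of_closed_of_induce_connected hs (by simpa) (by simp) (by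
    rintro x rfl y hy hxy
    exact (h y hy hxy.symm).elim)
  obtain ⟨x, hx, hxv⟩ := hne
  rw [← this] at hx
  exact hxv hx

end ClosedSets

section Pendant

variable {V : Type u} {G : SimpleGraph V} {s t : Set V}

/-- `A` is a nonempty subset of `s` attached to the rest of `G` through at most one vertex,
which lies in `s`. -/
def IsPendant (G : SimpleGraph V) (s A : Set V) : Prop :=
  A.Nonempty ∧ A ⊆ s ∧ ∃ a ∈ s, a ∉ A ∧ ∀ x ∈ A, ∀ y, G.Adj x y → y ∈ A ∨ y = a

/-- `s` contains two disjoint pendant subsets; this is the obstruction to contracting `s`. -/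
def HasPendantPair (G : SimpleGraph V) (s : Set V) : Prop :=
  ∃ A B, IsPendant G s A ∧ IsPendant G s B ∧ Disjoint A B

theorem IsPendant.mono {A : Set V} (h : IsPendant G s A) (hst : s ⊆ t) : IsPendant G t A := by
  obtain ⟨hne, hA, a, ha, h⟩ := h
  exact ⟨hne, hA.trans hst, a, hst ha, h⟩

theorem HasPendantPair.mono (h : HasPendantPair G s) (hst : s ⊆ t) : HasPendantPair G t := by
  obtain ⟨A, B, hA, hB, hAB⟩ := h
  exact ⟨A, B, hA.mono hst, hB.mono hst, hAB⟩

theorem IsPendant.notMem_of_adj {A : Set V} (h : IsPendant G s A) {v w : V} (hw : w ∉ s)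
    (hvw : G.Adj v w) : v ∉ A := by
  obtain ⟨-, hA, a, ha, -, h⟩ := h
  intro hv
  rcases h v hv w hvw with h | rfl
  · exact hw (hA h)
  · exact hw ha

theorem IsPendant.diff_singleton {A B : Set V} {v w : V} (hA : IsPendant G s A)
    (hB : IsPendant G s B) (hAB : Disjoint A B) (hw : w ∉ s) (hvw : G.Adj v w)
    (hc : (G.induce (s \ {v})).Connected) : IsPendant G (s \ {v}) A := by
  have hvA := hA.notMem_of_adj hw hvw
  have hvB := hB.notMem_of_adj hw hvw
  obtain ⟨hne, hAs, a, ha, haA, h⟩ := hA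
  have hAv : A ⊆ s \ {v} := Set.subset_sdiff_singleton hAs hvA
  refine ⟨hne, hAv, a, ⟨ha, ?_⟩, haA, h⟩
  rintro rfl
  have hAeq : A = s \ {a} := eq_of_closed_of_induce_connected hc hAv hne
    fun x hx y hy hxy => (h x hx y hxy).resolve_right hy.2
  obtain ⟨b, hb⟩ := hB.1
  exact hAB.notMem_of_mem_right hb (hAeq ▸ ⟨hB.2.1 hb, fun hba => hvB (hba ▸ hb)⟩)

theorem HasPendantPair.diff_singleton {v w : V} (h : HasPendantPair G s) (hw : w ∉ s)
    (hvw : G.Adj v w) (hc : (G.induce (s \ {v})).Connected) : HasPendantPair G (s \ {v}) := by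
  obtain ⟨A, B, hA, hB, hAB⟩ := h
  exact ⟨A, B, hA.diff_singleton hB hAB hw hvw hc, hB.diff_singleton hA hAB.symm hw hvw hc, hAB⟩

theorem not_hasPendantPair_singleton (v : V) : ¬ HasPendantPair G {v} := by
  rintro ⟨A, -, ⟨⟨x, hx⟩, hA, a, ha, haA, -⟩, -⟩
  rw [Set.mem_singleton_iff.1 ha, ← Set.mem_singleton_iff.1 (hA hx)] at haA
  exact haA hx

/-- If every vertex of `s` with a neighbour outside `s` is a cut vertex of `G.induce s`, then
every set separated from the rest of `s` by a single vertex contains a pendant set. -/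
theorem exists_isPendant_subset [Finite V] (hs : (G.induce s).Connected)
    (hcut : ∀ v ∈ s, ∀ w ∉ s, G.Adj v w → ¬ (G.induce (s \ {v})).Connected)
    (K : Set V) (hK : K.Nonempty) (hKs : K ⊆ s) {v : V} (hv : v ∈ s) (hvK : v ∉ K)
    (hcl : ∀ x ∈ K, ∀ y ∈ s, G.Adj x y → y ∈ K ∨ y = v) : ∃ A ⊆ K, IsPendant G s A := by
  induction hn : K.ncard using Nat.strong_induction_on generalizing K v with
  | _ n ih =>
  by_cases hbd : ∃ v' ∈ K, ∃ w ∉ s, G.Adj v' w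
  · obtain ⟨v', hv', w, hw, hvw⟩ := hbd
    have hvv : v ≠ v' := fun h => hvK (h ▸ hv')
    obtain ⟨t, hts, htne, hvt, hsep⟩ : ∃ t ⊆ s \ {v'}, t.Nonempty ∧ v ∉ t ∧
        ∀ x ∈ t, ∀ y ∈ (s \ {v'}) \ t, ¬ G.Adj x y := by
      obtain ⟨t, ht, htne, htne', hsep⟩ :=
        exists_closed_of_not_induce_connected (s := s \ {v'}) ⟨v, hv, hvv⟩
          (hcut v' (hKs hv') w hw hvw)
      by_cases hvt : v ∈ t
      · refine ⟨_, Set.sdiff_subset, htne', fun h => h.2 hvt, fun x hx y hy hxy => ?_⟩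
        exact hsep y (by simpa [hy.1.1, hy.1.2] using hy.2) x hx hxy.symm
      · exact ⟨t, ht, htne, hvt, hsep⟩
    have htcl : ∀ x ∈ t, ∀ y ∈ s, G.Adj x y → y ∈ t ∨ y = v' := by
      intro x hx y hy hxy
      by_contra! h
      exact hsep x hx y ⟨⟨hy, h.2⟩, h.1⟩ hxy
    have hv't : v' ∉ t := fun h => (hts h).2 rfl
    have hKt : (K ∩ t).Nonempty := by
      by_contra hempty
      rw [Set.not_nonempty_iff_eq_empty, ← Set.disjoint_iff_inter_eq_empty] at hempty
      have : t = s := by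
        refine eq_of_closed_of_induce_connected hs (hts.trans Set.sdiff_subset) htne
          fun x hx y hy hxy => (htcl x hx y hy hxy).resolve_right ?_
        rintro rfl
        rcases hcl y hv' x (hts hx).1 hxy.symm with h | rfl
        exacts [Set.disjoint_left.1 hempty h hx, hvt hx]
      exact hvt (this ▸ hv)
    have hlt : (K ∩ t).ncard < n := hn ▸ Set.ncard_lt_ncard
      ⟨Set.inter_subset_left, fun h => hv't (h hv').2⟩ K.toFinite
    obtain ⟨A, hAK, hA⟩ := ih _ hlt (K ∩ t) hKt (Set.inter_subset_left.trans hKs) (hKs hv')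
      (fun h => hv't h.2) (fun x hx y hy hxy => by
        refine (htcl x hx.2 y hy hxy).imp_left fun hyt => ⟨?_, hyt⟩
        exact (hcl x hx.1 y hy hxy).resolve_right fun h => hvt (h ▸ hyt)) rfl
    exact ⟨A, hAK.trans Set.inter_subset_left, hA⟩
  · push Not at hbd
    refine ⟨K, subset_rfl, hK, hKs, v, hv, hvK, fun x hx y hxy => ?_⟩
    by_cases hy : y ∈ s
    · exact hcl x hx y hy hxy
    · exact (hbd x hx y hy hxy).elim

theorem exists_removable [Finite V] (hG : G.Connected) (hs : (G.induce s).Connected)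
    (hne : s.Nontrivial) (huniv : s ≠ Set.univ) (hp : ¬ HasPendantPair G s) :
    ∃ v ∈ s, ∃ w ∉ s, G.Adj v w ∧ (s \ {v}).Nonempty ∧ (G.induce (s \ {v})).Connected := by
  have hdiff (v : V) : (s \ {v}).Nonempty := by
    obtain ⟨x, hx, hxv⟩ := hne.exists_ne v
    exact ⟨x, hx, hxv⟩
  by_contra! hcut
  replace hcut : ∀ v ∈ s, ∀ w ∉ s, G.Adj v w → ¬ (G.induce (s \ {v})).Connected :=
    fun v hv w hw hvw => hcut v hv w hw hvw (hdiff v)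
  obtain ⟨v, hv, w, hw, hvw⟩ := exists_adj_mem_notMem hG hne.nonempty huniv
  obtain ⟨t, ht, htne, htne', hsep⟩ :=
    exists_closed_of_not_induce_connected (hdiff v) (hcut v hv w hw hvw)
  obtain ⟨A, hAt, hA⟩ := exists_isPendant_subset hs hcut t htne (ht.trans Set.sdiff_subset) hv
    (fun h => (ht h).2 rfl) (fun x hx y hy hxy => by
      by_contra! h
      exact hsep x hx y ⟨⟨hy, h.2⟩, h.1⟩ hxy)
  obtain ⟨B, hBt, hB⟩ := exists_isPendant_subset hs hcut ((s \ {v}) \ t) htne'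
    (Set.sdiff_subset.trans Set.sdiff_subset) hv
    (fun h => h.1.2 rfl) (fun x hx y hy hxy => by
      by_contra! h
      have hyt : y ∈ t := by
        by_contra hyt
        exact h.1 ⟨⟨hy, h.2⟩, hyt⟩
      exact hsep y hyt x hx hxy.symm)
  exact hp ⟨A, B, hA, hB, Set.disjoint_sdiff_right.mono hAt hBt⟩

end Pendant

section Contraction

variable {V : Type u} {G : SimpleGraph V} {k : ℕ} {P Q : DistrictMap G k} {s : Set V}

theorem DistrictMap.eq_of_mem_of_mem (P : DistrictMap G k) {s t : Set V} (hs : s ∈ P.parts)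
    (ht : t ∈ P.parts) {x : V} (hxs : x ∈ s) (hxt : x ∈ t) : s = t := by
  by_contra hst
  exact Set.disjoint_left.1 (P.pairwise_disjoint hs ht hst) hxs hxt

theorem DistrictMap.ne_univ (P : DistrictMap G k) (hk : k ≠ 1) (hs : s ∈ P.parts) :
    s ≠ Set.univ := by
  rintro rfl
  refine hk (P.ncard_parts ▸ Set.ncard_eq_one.2 ⟨Set.univ, ?_⟩)
  ext t
  refine ⟨fun ht => ?_, fun ht => ht ▸ hs⟩
  obtain ⟨x, hx⟩ := P.nonempty_mem t ht
  exact P.eq_of_mem_of_mem ht hs hx trivial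

theorem SwitchedAt.ne_one {u v w : V} (h : SwitchedAt P Q u v w) : k ≠ 1 := by
  rintro rfl
  obtain ⟨su, sw, -, -, hsu, hsw, -, -, -, hne, -⟩ := h
  obtain ⟨r, hr⟩ := Set.ncard_eq_one.1 P.ncard_parts
  rw [hr] at hsu hsw
  exact hne (hsu.trans hsw.symm)

/-- A vertex may be moved from `s` to `t`, yielding a district map. -/
theorem DistrictMap.exists_move [Finite V] (P : DistrictMap G k) {s t : Set V}
    (hs : s ∈ P.parts) (ht : t ∈ P.parts) (hst : s ≠ t) {v w : V} (hv : v ∈ s) (hw : w ∈ t)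
    (hvw : G.Adj v w) (hne : (s \ {v}).Nonempty) (hc : (G.induce (s \ {v})).Connected) :
    ∃ Q : DistrictMap G k, Q.parts = (P.parts \ {s, t}) ∪ {s \ {v}, insert v t} := by
  have hdisj := P.pairwise_disjoint
  have hvt : v ∉ t := Set.disjoint_left.1 (hdisj hs ht hst) hv
  have hne' : s \ {v} ≠ insert v t := fun h => (h ▸ Set.mem_insert v t : v ∈ s \ {v}).2 rfl
  have hnew : Disjoint (P.parts \ {s, t}) {s \ {v}, insert v t} := by
    rw [Set.disjoint_left]
    rintro r ⟨hr, hr'⟩ (rfl | rfl)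
    · obtain ⟨x, hx⟩ := hne
      exact hr' (.inl (P.eq_of_mem_of_mem hr hs hx hx.1))
    · exact hr' (.inl (P.eq_of_mem_of_mem hr hs (Set.mem_insert v t) hv))
  refine ⟨⟨(P.parts \ {s, t}) ∪ {s \ {v}, insert v t}, ?_, ?_, ?_, ?_, ?_⟩, rfl⟩
  · have hsub : ({s, t} : Set (Set V)) ⊆ P.parts := by
      rintro r (rfl | rfl) <;> assumption
    rw [Set.ncard_union_eq hnew, Set.ncard_pair hne', ← Set.ncard_pair hst,
      Set.ncard_sdiff_add_ncard_of_subset hsub, P.ncard_parts]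
  · rintro r (hr | rfl | rfl)
    exacts [P.nonempty_mem r hr.1, hne, Set.insert_nonempty v t]
  · have hold : ∀ r ∈ P.parts \ {s, t}, Disjoint r (s \ {v}) ∧ Disjoint r (insert v t) := by
      rintro r ⟨hr, hrst⟩
      have hrs := hdisj hr hs fun h => hrst (.inl h)
      have hrt := hdisj hr ht fun h => hrst (.inr h)
      exact ⟨hrs.mono_right Set.sdiff_subset, Set.disjoint_insert_right.2
        ⟨Set.disjoint_right.1 hrs hv, hrt⟩⟩
    have hpair : Disjoint (s \ {v}) (insert v t) := Set.disjoint_insert_right.2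
      ⟨fun h => h.2 rfl, (hdisj hs ht hst).mono_left Set.sdiff_subset⟩
    rintro r (hr | rfl | rfl) r' (hr' | rfl | rfl) hrr
    exacts [hdisj hr.1 hr'.1 hrr, (hold r hr).1, (hold r hr).2, (hold r' hr').1.symm,
      (hrr rfl).elim, hpair, (hold r' hr').2.symm, hpair.symm, (hrr rfl).elim]
  · intro x
    obtain ⟨r, hr, hxr⟩ := P.covers x
    by_cases hxv : x = v
    · exact ⟨insert v t, .inr (.inr rfl), .inl hxv⟩
    by_cases hrs : r = s
    · exact ⟨s \ {v}, .inr (.inl rfl), hrs ▸ hxr, hxv⟩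
    by_cases hrt : r = t
    · exact ⟨insert v t, .inr (.inr rfl), .inr (hrt ▸ hxr)⟩
    · exact ⟨r, .inl ⟨hr, by rintro (h | h) <;> contradiction⟩, hxr⟩
  · rintro r (hr | rfl | rfl)
    · exact P.connected_mem r hr.1
    · exact hc
    · rw [show insert v t = {v, w} ∪ t by
        rw [Set.insert_union, Set.singleton_union, Set.insert_eq_of_mem hw]]
      exact induce_union_connected (induce_pair_connected_of_adj hvw).preconnected
        (P.connected_mem t ht).preconnected ⟨w, .inr rfl, hw⟩

theorem SwitchOut.hasPendantPair {s' : Set V} (h : SwitchOut P Q s s')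
    (hp : HasPendantPair G s) : HasPendantPair G s' := by
  obtain ⟨u, v, w, sw, -, hvw, hs, hsw, -, -, hw, hne, rfl, -, hc, -⟩ := h
  exact hp.diff_singleton (fun hws => hne (P.eq_of_mem_of_mem hs hsw hws hw)) hvw hc

theorem ContractibleDistrict.not_hasPendantPair (h : ContractibleDistrict P s) :
    ¬ HasPendantPair G s := by
  obtain ⟨t, -, f, g, -, rfl, hg, hstep⟩ := h
  intro hp
  have key (i : ℕ) (hi : i ≤ (g 0).ncard - 1) : HasPendantPair G (g i) := by
    induction i with
    | zero => exact hp
    | succ i ih => exact (hstep i hi).hasPendantPair (ih (Nat.le_of_succ_le hi))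
  exact not_hasPendantPair_singleton t (hg ▸ key _ le_rfl)

theorem contractibleDistrict_of_not_hasPendantPair [Finite V] (hG : G.Connected) (hk : k ≠ 1)
    (hs : s ∈ P.parts) (hp : ¬ HasPendantPair G s) : ContractibleDistrict P s := by
  obtain ⟨n, hn⟩ : ∃ n, s.ncard - 1 = n := ⟨_, rfl⟩
  have hpos : 0 < s.ncard := (Set.ncard_pos s.toFinite).2 (P.nonempty_mem s hs)
  induction n generalizing P s with
  | zero =>
    obtain ⟨t, rfl⟩ := Set.ncard_eq_one.1 (by omega : s.ncard = 1)
    exact ⟨t, hs, fun _ => P, fun _ => {t}, rfl, rfl, rfl, by simp⟩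
  | succ n ih =>
    have hnt : s.Nontrivial := (Set.one_lt_ncard_iff_nontrivial).1 (by omega)
    obtain ⟨v, hv, w, hw, hvw, hne, hc⟩ :=
      exists_removable hG (P.connected_mem s hs) hnt (P.ne_univ hk hs) hp
    obtain ⟨u, hu, huv⟩ := exists_adj_of_induce_connected (P.connected_mem s hs) hv hne
    obtain ⟨t, ht, hwt⟩ := P.covers w
    have hst : s ≠ t := fun h => hw (h ▸ hwt)
    obtain ⟨Q, hQ⟩ := P.exists_move hs ht hst hv hwt hvw hne hc
    have hcard : (s \ {v}).ncard = s.ncard - 1 := Set.ncard_sdiff_singleton_of_mem hv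
    obtain ⟨x, -, f, g, hf, hg, hgx, hstep⟩ := ih (P := Q) (s := s \ {v})
      (hQ ▸ .inr (.inl rfl)) (fun h => hp (h.mono Set.sdiff_subset)) (by omega) (by omega)
    refine ⟨x, hs, fun i => Nat.casesOn i P f, fun i => Nat.casesOn i s g, rfl, rfl, ?_, ?_⟩
    · rw [hn]
      rwa [show (s \ {v}).ncard - 1 = n by omega] at hgx
    · rintro (_ | i) hi
      · refine ⟨u, v, w, t, huv, hvw, hs, ht, hu, hv, hwt, hst, hg, ?_, ?_, ?_⟩
        · change (g 0).Nonempty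
          rwa [hg]
        · change (G.induce (g 0)).Connected
          rwa [hg]
        · change (f 0).parts = (P.parts \ {s, t}) ∪ {g 0, insert v t}
          rw [hf, hg, hQ]
      · exact hstep i (by omega)

theorem contractibleMap_iff [Finite V] (hG : G.Connected) (hk : k ≠ 1) :
    ContractibleMap P ↔ ∀ s ∈ P.parts, ¬ HasPendantPair G s :=
  ⟨fun h s hs => (h s hs).not_hasPendantPair,
    fun h s hs => contractibleDistrict_of_not_hasPendantPair hG hk hs (h s hs)⟩

theorem Switch.contractibleMap_iff [Finite V] (hG : G.Connected) (h : Switch P Q) :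
    ContractibleMap P ↔ ContractibleMap Q := by
  obtain ⟨u, v, w, h⟩ := h
  have hk := h.ne_one
  rw [_root_.contractibleMap_iff hG hk, _root_.contractibleMap_iff hG hk]
  obtain ⟨su, sw, huv, hvw, hsu, hsw, hu, hv, hw, hne, -, hc, hQ⟩ := h
  have hdisj := P.pairwise_disjoint hsu hsw hne
  have hvsw : v ∉ sw := Set.disjoint_left.1 hdisj hv
  have husw : u ∉ insert v sw := by
    rintro (rfl | hu')
    exacts [huv.ne rfl, Set.disjoint_left.1 hdisj hu hu']
  have hins : insert v sw \ {v} = sw := Set.insert_sdiff_self_of_notMem hvsw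
  rw [hQ]
  constructor
  · rintro hP t (ht | rfl | rfl) hp
    · exact hP t ht.1 hp
    · exact hP su hsu (hp.mono Set.sdiff_subset)
    · have := hp.diff_singleton husw huv.symm (by rw [hins]; exact P.connected_mem sw hsw)
      exact hP sw hsw (hins ▸ this)
  · intro hQ t ht hp
    by_cases htu : t = su
    · subst htu
      exact hQ _ (.inr (.inl rfl))
        (hp.diff_singleton (Set.disjoint_right.1 hdisj hw) hvw hc)
    by_cases htw : t = sw
    · exact hQ _ (.inr (.inr rfl)) (hp.mono (htw ▸ Set.subset_insert v sw))
    · exact hQ t (.inl ⟨ht, by rintro (h | h) <;> contradiction⟩) hp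

end Contraction

/-- Contractibility of a `k`-district map is invariant under switch
operations: two maps in the same component of the switch graph are either both
contractible or both incontractible. -/
theorem contractible_invariant {V : Type u} [Fintype V] (G : SimpleGraph V)
    (hG : G.Connected) (k : ℕ) (P Q : DistrictMap G k)
    (h : Relation.ReflTransGen SwitchAdj P Q) :
    ContractibleMap P ↔ ContractibleMap Q := by
  induction h with
  | refl => rfl
  | tail _ h ih =>
    rcases h with h | h
    · exact ih.trans (h.contractibleMap_iff hG)
    · exact ih.trans (h.contractibleMap_iff hG).symm
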